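/- arXiv:2510.23097 — 4 statements merged into one kernel-verified Lean document; each statement's English description precedes it below -/
import Mathlib

section
/- Let k be an algebraically closed field and f ∈ k[X] a polynomial with natDegree f ≥ 1. For every n ≥ 1, the branch locus of the n-th iterate equals the union of the first n forward images of the critical set: { eval x (f^{∘n}) | x ∈ k, eval x (derivative (f^{∘n})) = 0 } = ⋃_{m=1}^{n} { eval c (f^{∘m}) | c ∈ k, eval c (derivative f) = 0 }. -/
open Polynomial

/-- The `n`-fold composite of a polynomial: `f^{∘0} = X`, `f^{∘(n+1)} = f^{∘n} ∘ f`. -/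
noncomputable def iterComp {R : Type*} [CommRing R] (f : R[X]) : ℕ → R[X]
  | 0 => X
  | n + 1 => (iterComp f n).comp f

/-- A nonconstant polynomial over an algebraically closed field is surjective. -/
theorem eval_surjective_of_natDegree_pos {k : Type*} [Field k] [IsAlgClosed k]
    {f : k[X]} (hf : 0 < f.natDegree) : Function.Surjective fun x => eval x f := by
  intro y
  have hdeg : (f - C y).degree ≠ 0 := by
    rw [degree_sub_C (natDegree_pos_iff_degree_pos.mp hf)]
    exact (natDegree_pos_iff_degree_pos.mp hf).ne'
  obtain ⟨x, hx⟩ := IsAlgClosed.exists_root _ hdeg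
  exact ⟨x, by simpa [sub_eq_zero] using hx⟩

theorem eval_iterComp_succ {R : Type*} [CommRing R] (f : R[X]) (n : ℕ) (x : R) :
    eval x (iterComp f (n + 1)) = eval (eval x f) (iterComp f n) :=
  eval_comp

theorem eval_derivative_iterComp_succ {R : Type*} [CommRing R] (f : R[X]) (n : ℕ) (x : R) :
    eval x (derivative (iterComp f (n + 1))) =
      eval x (derivative f) * eval (eval x f) (derivative (iterComp f n)) := by
  simp [iterComp, derivative_comp]

theorem exists_critical_iterComp_iff {k : Type*} [Field k] [IsAlgClosed k]
    {f : k[X]} (hf : 0 < f.natDegree) (n : ℕ) (y : k) :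
    (∃ x, eval x (derivative (iterComp f n)) = 0 ∧ eval x (iterComp f n) = y) ↔
      ∃ m ∈ Finset.Icc 1 n, ∃ c, eval c (derivative f) = 0 ∧ eval c (iterComp f m) = y := by
  induction n with
  | zero => simp [iterComp]
  | succ n ih =>
    rw [(eval_surjective_of_natDegree_pos hf).exists] at ih
    rw [← Finset.insert_Icc_right_eq_Icc_add_one (Nat.le_add_left 1 n), Finset.exists_mem_insert,
      ← ih]
    simp only [eval_derivative_iterComp_succ, eval_iterComp_succ, mul_eq_zero, or_and_right,
      exists_or]

/-- Branch locus of the `n`-th iterate equals the union of the first `n` forward images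
of the critical set: `Br(f^{∘n}) = ⋃_{m=1}^{n} f^{m}(Crit f)`. -/
theorem branchLocus_iterComp {k : Type*} [Field k] [IsAlgClosed k]
    (f : k[X]) (hf : 1 ≤ f.natDegree) (n : ℕ) (hn : 1 ≤ n) :
    {y : k | ∃ x : k, eval x (derivative (iterComp f n)) = 0 ∧ eval x (iterComp f n) = y} =
      ⋃ m ∈ Finset.Icc 1 n,
        {y : k | ∃ c : k, eval c (derivative f) = 0 ∧ eval c (iterComp f m) = y} := by
  ext y
  simpa only [Set.mem_iUnion, Set.mem_ofPred_eq, exists_prop] using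
    exists_critical_iterComp_iff hf n y
end

section
/- Let k be an algebraically closed field, f ∈ k[X] with natDegree f ≥ 1, and a ∈ k. The following are equivalent: (i) for every n ≥ 1 the polynomial f^{∘n} − C a is separable; (ii) for every m ≥ 1 and every c ∈ k with eval c (derivative f) = 0 one has eval c (f^{∘m}) ≠ a, i.e. a does not lie in the postcritical set ⋃_{m≥1} f^{m}(Crit f). -/
open Polynomial

/-- Over an algebraically closed field, `p - C a` is separable iff no point of the fiber of `p`
over `a` is critical for `p`. -/
theorem separable_sub_C_iff {k : Type*} [Field k] [IsAlgClosed k] (p : k[X]) (a : k) :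
    (p - C a).Separable ↔ ∀ x : k, eval x p = a → eval x (derivative p) ≠ 0 := by
  rw [separable_def, isCoprime_iff_aeval_ne_zero_of_isAlgClosed k k]
  simp [sub_eq_zero, or_iff_not_imp_left]

/-- If `a` is not postcritical for `f`, no iterate of `f` has a critical point over `a`. -/
theorem eval_derivative_iterComp_ne_zero {R : Type*} [CommRing R] [IsDomain R] {f : R[X]} {a : R}
    (h : ∀ m : ℕ, 1 ≤ m → ∀ c : R, eval c (derivative f) = 0 → eval c (iterComp f m) ≠ a)
    (n : ℕ) (x : R) (hx : eval x (iterComp f n) = a) :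
    eval x (derivative (iterComp f n)) ≠ 0 := by
  induction n generalizing x with
  | zero => simp [iterComp]
  | succ n ih =>
    rw [eval_derivative_iterComp_succ]
    refine mul_ne_zero (fun hc => h (n + 1) n.succ_pos x hc hx) (ih _ ?_)
    rwa [iterComp, eval_comp] at hx

/-- Étale fibers for all iterates ⟺ non-postcritical: all level-`n` fiber polynomials
`f^{∘n} - C a` are separable for all `n ≥ 1` iff `a` is not in the postcritical set
`⋃_{m ≥ 1} f^m(Crit f)`. -/
theorem separable_iterComp_sub_C_iff_not_postcritical {k : Type*} [Field k] [IsAlgClosed k]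
    (f : k[X]) (hf : 1 ≤ f.natDegree) (a : k) :
    (∀ n : ℕ, 1 ≤ n → (iterComp f n - C a).Separable) ↔
      (∀ m : ℕ, 1 ≤ m → ∀ c : k, eval c (derivative f) = 0 → eval c (iterComp f m) ≠ a) := by
  simp only [separable_sub_C_iff]
  refine ⟨fun h m hm c hc hca => ?_, fun h n _ => eval_derivative_iterComp_ne_zero h n⟩
  obtain ⟨n, rfl⟩ := Nat.exists_eq_add_of_le' hm
  exact h (n + 1) hm c hca (by rw [eval_derivative_iterComp_succ, hc, zero_mul])
end

section
/- Let O be a local integral domain with maximal ideal m, residue field k = O/m with residue map π : O → k, and fraction field K. Let f ∈ O[X] with IsUnit (leadingCoeff f). If the reduction f.map π ∈ k[X] is separable, then the polynomial f.map (algebraMap O K) ∈ K[X] is separable. -/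
open Polynomial

/-- Over a local ring, two polynomials, the first of which has unit leading coefficient, are
coprime if their reductions to the residue field are. -/
theorem Polynomial.isCoprime_of_map_residue {R : Type*} [CommRing R] [IsLocalRing R]
    {f g : R[X]} (hlc : IsUnit f.leadingCoeff)
    (h : IsCoprime (f.map (IsLocalRing.residue R)) (g.map (IsLocalRing.residue R))) :
    IsCoprime f g := by
  rw [← Ideal.isCoprime_span_singleton_iff, Ideal.isCoprime_iff_sup_eq]
  by_contra hne
  obtain ⟨M, hM, hle⟩ := Ideal.exists_le_maximal _ hne
  have hf : f ∈ M := hle (Ideal.mem_sup_left (Ideal.mem_span_singleton_self f))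
  have hg : g ∈ M := hle (Ideal.mem_sup_right (Ideal.mem_span_singleton_self g))
  have hint : ((Ideal.Quotient.mk M).comp (C : R →+* R[X])).IsIntegral :=
    (monic_of_isUnit_leadingCoeff_inv_smul hlc).quotient_isIntegral
      (Submodule.smul_of_tower_mem M (hlc.unit⁻¹ : Rˣ) hf)
  have hcomap : M.comap (C : R →+* R[X]) = IsLocalRing.maximalIdeal R := by
    have := (Ideal.bot_quotient_isMaximal_iff M).mpr hM
    have hmax := Ideal.isMaximal_comap_of_isIntegral_of_isMaximal' _ hint ⊥
    rw [← Ideal.comap_comap, ← RingHom.ker_eq_comap_bot, Ideal.mk_ker] at hmax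
    exact IsLocalRing.eq_maximalIdeal hmax
  obtain ⟨a, b, hab⟩ := h
  obtain ⟨a, rfl⟩ := map_surjective _ IsLocalRing.residue_surjective a
  obtain ⟨b, rfl⟩ := map_surjective _ IsLocalRing.residue_surjective b
  have hker : a * f + b * g - 1 ∈ M := by
    have hmem : a * f + b * g - 1 ∈ (IsLocalRing.maximalIdeal R).map C := by
      rw [← IsLocalRing.ker_residue, ← ker_mapRingHom, RingHom.mem_ker]
      simp [hab]
    exact Ideal.map_le_iff_le_comap.mpr hcomap.ge hmem
  refine hM.ne_top ((Ideal.eq_top_iff_one M).mpr ?_)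
  simpa using M.sub_mem (M.add_mem (M.mul_mem_left a hf) (M.mul_mem_left b hg)) hker

/-- Separability lifting: if `f ∈ O[X]` has unit leading coefficient over a local
integral domain `O` and its reduction mod the maximal ideal is separable, then the
polynomial `f` viewed over the fraction field `K` is separable. -/
theorem separable_map_fractionRing_of_separable_residue
    {O : Type*} [CommRing O] [IsDomain O] [IsLocalRing O]
    (f : O[X]) (hlc : IsUnit f.leadingCoeff)
    (hsep : (f.map (IsLocalRing.residue O)).Separable) :
    (f.map (algebraMap O (FractionRing O))).Separable := by
  rw [Polynomial.Separable, derivative_map] at hsep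
  exact Separable.map (isCoprime_of_map_residue hlc hsep)
end

section
/- Let K be a field, f ∈ K[X], α ∈ K with α ≠ 0, and β ∈ K. Let ℓ = C α · X + C β and ℓ' = C α⁻¹ · X − C (α⁻¹ · β) (so ℓ and ℓ' are mutually inverse affine maps), and let g = (ℓ ∘ f) ∘ ℓ' be the affine conjugate of f. Then for every n ≥ 1 and every x ∈ K, the subfield of an algebraic closure of K generated over K by the roots of g^{∘n} − C (α·x + β) equals the subfield generated over K by the roots of f^{∘n} − C x. In particular the splitting fields of the level-n fiber polynomials of f at x and of g at ℓ(x) coincide. -/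
open Polynomial

theorem iterComp_conj {R : Type*} [CommRing R] {l l' : R[X]} (h : l'.comp l = X)
    (h' : l.comp l' = X) (f : R[X]) (n : ℕ) :
    iterComp ((l.comp f).comp l') n = (l.comp (iterComp f n)).comp l' := by
  induction n with
  | zero => simp [iterComp, h']
  | succ n ih =>
    calc (iterComp ((l.comp f).comp l') n).comp ((l.comp f).comp l')
        = (l.comp (iterComp f n)).comp ((l'.comp l).comp (f.comp l')) := by
          rw [ih]; simp only [comp_assoc]
      _ = (l.comp ((iterComp f n).comp f)).comp l' := by
          rw [h, X_comp]; simp only [comp_assoc]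

theorem rootSet_C_mul {K L : Type*} [Field K] [Field L] [Algebra K L] {a : K} (ha : a ≠ 0)
    (p : K[X]) : (C a * p).rootSet L = p.rootSet L := by
  ext y
  simp [mem_rootSet, ha]

theorem adjoin_rootSet_comp_le {K L : Type*} [Field K] [Field L] [Algebra K L]
    {l l' : K[X]} (h' : l.comp l' = X) (p : K[X]) :
    IntermediateField.adjoin K ((p.comp l').rootSet L) ≤
      IntermediateField.adjoin K (p.rootSet L) := by
  rw [IntermediateField.adjoin_le_iff]
  intro y hy
  obtain ⟨hp, hy⟩ := mem_rootSet.mp hy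
  rw [aeval_comp] at hy
  have hmem : aeval y l' ∈ IntermediateField.adjoin K (p.rootSet L) :=
    IntermediateField.subset_adjoin K _
      (mem_rootSet.mpr ⟨fun h0 => hp (by rw [h0, zero_comp]), hy⟩)
  have hl : aeval (aeval y l') l = y := by rw [← aeval_comp, h', aeval_X]
  rw [← hl]
  exact IntermediateField.aeval_coe (IntermediateField.adjoin K (p.rootSet L)) ⟨_, hmem⟩ l ▸
    SetLike.coe_mem _

theorem adjoin_rootSet_comp {K L : Type*} [Field K] [Field L] [Algebra K L]
    {l l' : K[X]} (h : l'.comp l = X) (h' : l.comp l' = X) (p : K[X]) :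
    IntermediateField.adjoin K ((p.comp l').rootSet L) =
      IntermediateField.adjoin K (p.rootSet L) := by
  refine le_antisymm (adjoin_rootSet_comp_le h' p) ?_
  simpa only [comp_assoc, h, comp_X] using adjoin_rootSet_comp_le (L := L) h (p.comp l')

/-- Invariance of the level-`n` fiber fields under affine conjugation (Proposition
4.1(c)): if `ℓ(z) = αz + β` with inverse `ℓ'` and `g = ℓ ∘ f ∘ ℓ'`, then for all
`n ≥ 1` and `x ∈ K`, the field generated over `K` by the roots of
`g^{∘n} − C (αx + β)` equals the field generated over `K` by the roots of
`f^{∘n} − C x`. -/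
theorem adjoin_rootSet_affine_conjugate
    {K : Type*} [Field K] (f : K[X]) (α β : K) (hα : α ≠ 0) (n : ℕ) (hn : 1 ≤ n) (x : K) :
    IntermediateField.adjoin K
        ((iterComp (((C α * X + C β).comp f).comp (C α⁻¹ * X - C (α⁻¹ * β))) n -
          C (α * x + β)).rootSet (AlgebraicClosure K)) =
      IntermediateField.adjoin K
        ((iterComp f n - C x).rootSet (AlgebraicClosure K)) := by
  have h : (C α⁻¹ * X - C (α⁻¹ * β)).comp (C α * X + C β) = X := by
    simp only [sub_comp, mul_comp, C_comp, X_comp, mul_add, ← mul_assoc, ← C_mul,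
      inv_mul_cancel₀ hα, C_1, one_mul, add_sub_cancel_right]
  have h' : (C α * X + C β).comp (C α⁻¹ * X - C (α⁻¹ * β)) = X := by
    simp only [add_comp, mul_comp, C_comp, X_comp, mul_sub, ← mul_assoc, ← C_mul,
      mul_inv_cancel₀ hα, C_1, one_mul, sub_add_cancel]
  have key : iterComp (((C α * X + C β).comp f).comp (C α⁻¹ * X - C (α⁻¹ * β))) n -
      C (α * x + β) =
        (C α * (iterComp f n - C x)).comp (C α⁻¹ * X - C (α⁻¹ * β)) := by
    rw [iterComp_conj h h']
    simp only [add_comp, sub_comp, mul_comp, C_comp, X_comp, C_add, C_mul]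
    ring
  rw [key, adjoin_rootSet_comp h h', rootSet_C_mul hα]
end
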